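/- Let U ⊆ ℂ be an open set, let f₁, …, f_α be functions analytic on U, let b ∈ U, and suppose there is a nonzero vector (c₁, …, c_α) ∈ ℂ^α such that g = c₁f₁ + ⋯ + c_αf_α vanishes to order at least φ at b, where φ ≥ α − 1. Then the Wronskian W(f₁, …, f_α) vanishes to order at least φ − (α − 1) at b. -/

import Mathlib

open Topology

lemma AnalyticAt.matrix_det {n : Type*} [Fintype n] [DecidableEq n] {M : ℂ → Matrix n n ℂ} {b : ℂ}
    (hM : ∀ i j, AnalyticAt ℂ (fun t => M t i j) b) :
    AnalyticAt ℂ (fun t => (M t).det) b := by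
  simp only [Matrix.det_apply']
  exact Finset.analyticAt_fun_sum _ fun σ _ =>
    analyticAt_const.mul (Finset.analyticAt_fun_prod _ fun i _ => hM _ _)

lemma AnalyticAt.matrix_adjugate {n : Type*} [Fintype n] [DecidableEq n]
    {M : ℂ → Matrix n n ℂ} {b : ℂ} (hM : ∀ i j, AnalyticAt ℂ (fun t => M t i j) b) (i j : n) :
    AnalyticAt ℂ (fun t => (M t).adjugate i j) b := by
  simp only [Matrix.adjugate_apply]
  refine AnalyticAt.matrix_det fun k l => ?_
  by_cases hk : k = j
  · simpa [Matrix.updateRow_apply, hk] using analyticAt_const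
  · simpa [Matrix.updateRow_apply, hk] using hM k l

lemma le_analyticOrderAt_sum {ι : Type*} (s : Finset ι) {F : ι → ℂ → ℂ} {b : ℂ} {n : ℕ∞}
    (hF : ∀ i ∈ s, n ≤ analyticOrderAt (F i) b) :
    n ≤ analyticOrderAt (∑ i ∈ s, F i) b := by
  refine Finset.sum_induction F (fun G => n ≤ analyticOrderAt G b)
    (fun _ _ hG hH => (le_min hG hH).trans le_analyticOrderAt_add) ?_ hF
  have h : analyticOrderAt (0 : ℂ → ℂ) b = ⊤ := by simp [analyticOrderAt_eq_top]
  simp [h]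

lemma Matrix.det_eq_sum_adjugate_mul_mulVec {n K : Type*} [Fintype n] [DecidableEq n] [Field K]
    (M : Matrix n n K) (c : n → K) {k : n} (hk : c k ≠ 0) :
    M.det = ∑ i, (c k)⁻¹ * M.adjugate k i * (M.mulVec c) i := by
  have h := congrFun (Matrix.mulVec_mulVec c M.adjugate M) k
  rw [Matrix.adjugate_mul, Matrix.smul_mulVec, Matrix.one_mulVec, Pi.smul_apply, smul_eq_mul] at h
  simp only [mul_assoc, ← Finset.mul_sum]
  change _ = _ * (M.adjugate.mulVec (M.mulVec c)) k
  rw [h]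
  field_simp

/-- If a nonzero constant linear combination of the analytic functions
`f₁, …, f_α` vanishes to order at least `φ ≥ α − 1` at `b ∈ U`, then the
Wronskian `W(f₁, …, f_α)` vanishes to order at least `φ − (α − 1)` at `b`. -/
theorem wronskian_vanishes_to_order_of_combination
    (U : Set ℂ) (hUo : IsOpen U) (α : ℕ) (f : Fin α → ℂ → ℂ)
    (hf : ∀ j, AnalyticOnNhd ℂ (f j) U)
    (b : ℂ) (hb : b ∈ U) (φ : ℕ) (hφ : α - 1 ≤ φ)
    (c : Fin α → ℂ) (hc : c ≠ 0)
    (hvanish : ∀ i < φ, iteratedDeriv i (fun t => ∑ j, c j * f j t) b = 0) :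
    ∀ m < φ - (α - 1),
      iteratedDeriv m (fun t =>
        Matrix.det (Matrix.of fun i j : Fin α => iteratedDeriv (i : ℕ) (f j) t)) b = 0 := by
  obtain ⟨k, hk⟩ := Function.ne_iff.mp hc
  set M : ℂ → Matrix (Fin α) (Fin α) ℂ :=
    fun t => Matrix.of fun i j => iteratedDeriv (i : ℕ) (f j) t
  set g : ℂ → ℂ := fun t => ∑ j, c j * f j t with hgdef
  have analyticAt_iteratedDeriv {h : ℂ → ℂ} (hh : AnalyticAt ℂ h b) (i : ℕ) :
      AnalyticAt ℂ (iteratedDeriv i h) b := by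
    rw [iteratedDeriv_eq_iterate]
    exact hh.iterated_deriv i
  have hg : AnalyticAt ℂ g b :=
    Finset.analyticAt_fun_sum _ fun j _ => analyticAt_const.mul (hf j b hb)
  have hM (i j : Fin α) : AnalyticAt ℂ (fun t => M t i j) b :=
    analyticAt_iteratedDeriv (hf j b hb) i
  have hMc (t : ℂ) (ht : t ∈ U) (i : Fin α) :
      (M t).mulVec c i = iteratedDeriv (i : ℕ) g t := by
    have hcd (j : Fin α) : ContDiffAt ℂ (i : ℕ) (fun t => c j * f j t) t :=
      contDiffAt_const.mul (hf j t ht).contDiffAt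
    rw [hgdef, iteratedDeriv_fun_sum fun j _ => hcd j]
    simp [M, Matrix.mulVec, dotProduct, mul_comm]
  have hW : (fun t => (M t).det) =ᶠ[𝓝 b] ∑ i, (fun t => (c k)⁻¹ * (M t).adjugate k i) *
      iteratedDeriv (i : ℕ) g := by
    filter_upwards [hUo.mem_nhds hb] with t ht
    rw [Matrix.det_eq_sum_adjugate_mul_mulVec (M t) c hk]
    simp [hMc t ht]
  refine (natCast_le_analyticOrderAt_iff_iteratedDeriv_eq_zero (AnalyticAt.matrix_det hM)).mp ?_
  rw [analyticOrderAt_congr hW]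
  refine le_analyticOrderAt_sum _ fun i _ => ?_
  have hgi := analyticAt_iteratedDeriv hg i
  have hadj : AnalyticAt ℂ (fun t => (c k)⁻¹ * (M t).adjugate k i) b :=
    analyticAt_const.mul (AnalyticAt.matrix_adjugate hM k i)
  rw [analyticOrderAt_mul hadj hgi]
  refine le_add_left ((natCast_le_analyticOrderAt_iff_iteratedDeriv_eq_zero hgi).mpr fun l hl => ?_)
  have hadd : iteratedDeriv l (iteratedDeriv (i : ℕ) g) = iteratedDeriv (l + i) g := by
    simp only [iteratedDeriv_eq_iterate, Function.iterate_add_apply]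
  rw [hadd]
  exact hvanish _ (by omega)
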